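/- The identity 4096 · Σ_{n odd} tanh(nπ/2)/n^9 = 37π^9/315 + 512π · Σ_{n odd} sech²(nπ/2)/n^8 holds, where both sums run over odd positive integers n. -/

import Mathlib

section Aux
open Real

lemma aux_coth (x : ℝ) (hx : x ≠ 0) :
    HasSum (fun n : ℕ => 2 * x / (x ^ 2 + ((n : ℝ) + 1) ^ 2))
      (π * (cosh (π * x) / sinh (π * x)) - 1 / x) := by
  have hz : (x * Complex.I : ℂ) ∈ Complex.integerComplement := by
    rintro ⟨n, hn⟩
    have := congrArg Complex.im hn
    simp at this
    exact hx this.symm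
  have h1 := (summable_cotTerm hz).hasSum
  have h2 := cot_series_rep' hz
  simp only [cotTerm] at h1
  rw [← h2] at h1
  have h3 := h1.mul_left Complex.I
  rw [← Complex.hasSum_ofReal]
  have hxc : (x : ℂ) ≠ 0 := by exact_mod_cast hx
  have hI := Complex.I_sq
  convert! h3 using 1
  · ext n
    have hk : ((x : ℂ) ^ 2 + ((n : ℂ) + 1) ^ 2) ≠ 0 := by
      have : (x ^ 2 + ((n : ℝ) + 1) ^ 2) ≠ 0 := by positivity
      exact_mod_cast this
    have e : (x * Complex.I - ((n : ℂ) + 1)) * (x * Complex.I + ((n : ℂ) + 1))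
        = - ((x : ℂ) ^ 2 + ((n : ℂ) + 1) ^ 2) := by
      linear_combination (x : ℂ) ^ 2 * hI
    have hne : (x * Complex.I - ((n : ℂ) + 1)) * (x * Complex.I + ((n : ℂ) + 1)) ≠ 0 := by
      rw [e]; exact neg_ne_zero.mpr hk
    have ha := left_ne_zero_of_mul hne
    have hb := right_ne_zero_of_mul hne
    rw [div_add_div _ _ ha hb, e]
    push_cast
    rw [← mul_div_assoc, div_neg, ← neg_div]
    congr 1
    linear_combination (2 : ℂ) * x * hI
  · have hs : (Complex.sinh (π * x)) ≠ 0 := by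
      have : sinh (π * x) ≠ 0 := by
        rw [Ne, sinh_eq_zero]; positivity
      exact_mod_cast this
    rw [Complex.cot_eq_cos_div_sin, ← mul_assoc, Complex.cos_mul_I, Complex.sin_mul_I]
    push_cast
    field_simp

lemma aux_tanh (x : ℝ) :
    HasSum (fun n : ℕ => 4 / π * (x / (x ^ 2 + (2 * (n : ℝ) + 1) ^ 2))) (tanh (π / 2 * x)) := by
  rcases eq_or_ne x 0 with rfl | hx
  · simp [hasSum_zero]
  have h1 := aux_coth x hx
  have h2 := (aux_coth (x / 2) (by positivity)).mul_left (1 / 2)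
  have hodd : Summable (fun n : ℕ => 2 * x / (x ^ 2 + (((2 * n : ℕ) : ℝ) + 1) ^ 2)) :=
    h1.summable.comp_injective (i := fun n : ℕ => 2 * n) (fun a b h => by dsimp only at h; omega)
  have h3 : HasSum (fun n : ℕ => 2 * x / (x ^ 2 + (((2 * n + 1 : ℕ) : ℝ) + 1) ^ 2)) 
      (1 / 2 * (π * (cosh (π * (x / 2)) / sinh (π * (x / 2))) - 1 / (x / 2))) := by
    convert! h2 using 1
    ext n
    push_cast
    have : (x ^ 2 + (2 * (n : ℝ) + 1 + 1) ^ 2) ≠ 0 := by positivity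
    have : ((x/2) ^ 2 + ((n : ℝ) + 1) ^ 2) ≠ 0 := by positivity
    field_simp
    ring
  have h4 := (HasSum.even_add_odd (f := fun n : ℕ => 2 * x / (x ^ 2 + ((n : ℝ) + 1) ^ 2)) hodd.hasSum h3).unique h1
  have h5 := hodd.hasSum.mul_left (2 / π)
  convert! h5 using 1
  · ext n; push_cast; ring
  · have : (∑' n : ℕ, 2 * x / (x ^ 2 + (((2 * n : ℕ) : ℝ) + 1) ^ 2)) = _ := eq_sub_of_add_eq h4
    rw [this, tanh_eq_sinh_div_cosh]
    have e1 : π * x = 2 * (π / 2 * x) := by ring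
    have e2 : π * (x / 2) = π / 2 * x := by ring
    rw [e2, e1, cosh_two_mul, sinh_two_mul]
    have hs : sinh (π / 2 * x) ≠ 0 := by
        rw [Ne, sinh_eq_zero]; positivity
    have hc := (cosh_pos (π / 2 * x)).ne'
    have := pi_pos.ne'
    field_simp
    ring

lemma aux_lam (k : ℕ) (s : ℝ) (h : HasSum (fun n : ℕ => (1 : ℝ) / (n : ℝ) ^ k) s) :
    HasSum (fun n : ℕ => (1 : ℝ) / (2 * (n : ℝ) + 1) ^ k) (s * (1 - 1 / 2 ^ k)) := by
  have hodd : Summable (fun n : ℕ => (1 : ℝ) / (((2 * n + 1 : ℕ) : ℝ)) ^ k) :=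
    h.summable.comp_injective (i := fun n : ℕ => 2 * n + 1) (fun a b h => by dsimp only at h; omega)
  have h3 : HasSum (fun n : ℕ => (1 : ℝ) / (((2 * n : ℕ) : ℝ)) ^ k) (1 / 2 ^ k * s) := by
    convert! h.mul_left (1 / 2 ^ k) using 1
    ext n
    push_cast
    rw [mul_pow]
    simp [mul_comm]
  have h4 := (HasSum.even_add_odd (f := fun n : ℕ => (1 : ℝ) / (n : ℝ) ^ k) h3 hodd.hasSum).unique h
  have h5 := hodd.hasSum
  convert! h5 using 1
  · ext n; push_cast; rfl
  · linear_combination -h4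

lemma aux_l2 : HasSum (fun n : ℕ => (1 : ℝ) / (2 * (n : ℝ) + 1) ^ 2) (π ^ 2 / 8) := by
  convert! aux_lam 2 _ hasSum_zeta_two using 1
  ring

lemma aux_l4 : HasSum (fun n : ℕ => (1 : ℝ) / (2 * (n : ℝ) + 1) ^ 4) (π ^ 4 / 96) := by
  convert! aux_lam 4 _ hasSum_zeta_four using 1
  ring

lemma aux_b6 : bernoulli' 6 = 1 / 42 := by
  have h5 : bernoulli' 5 = 0 := bernoulli'_eq_zero_of_odd (by decide) (by norm_num)
  rw [bernoulli'_def]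
  norm_num [Finset.sum_range_succ, h5, Nat.choose]

lemma aux_b8 : bernoulli' 8 = -1 / 30 := by
  have h5 : bernoulli' 5 = 0 := bernoulli'_eq_zero_of_odd (by decide) (by norm_num)
  have h7 : bernoulli' 7 = 0 := bernoulli'_eq_zero_of_odd (by decide) (by norm_num)
  rw [bernoulli'_def]
  norm_num [Finset.sum_range_succ, h5, h7, aux_b6, Nat.choose]

lemma aux_l6 : HasSum (fun n : ℕ => (1 : ℝ) / (2 * (n : ℝ) + 1) ^ 6) (π ^ 6 / 960) := by
  convert! aux_lam 6 _ (hasSum_zeta_nat (k := 3) (by norm_num)) using 1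
  rw [bernoulli_eq_bernoulli'_of_ne_one (by norm_num), aux_b6]
  norm_num [Nat.factorial]
  ring

lemma aux_l8 : HasSum (fun n : ℕ => (1 : ℝ) / (2 * (n : ℝ) + 1) ^ 8) (17 * π ^ 8 / 161280) := by
  convert! aux_lam 8 _ (hasSum_zeta_nat (k := 4) (by norm_num)) using 1
  rw [bernoulli_eq_bernoulli'_of_ne_one (by norm_num), aux_b8]
  norm_num [Nat.factorial]
  ring

lemma aux_sech (x : ℝ) :
    HasSum (fun n : ℕ => 4 / π * (((2 * (n : ℝ) + 1) ^ 2 - x ^ 2) /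
      (x ^ 2 + (2 * (n : ℝ) + 1) ^ 2) ^ 2)) (π / 2 * (1 / cosh (π / 2 * x)) ^ 2) := by
  have hp := pi_pos
  have hb : ∀ (n : ℕ) (y : ℝ), ‖4 / π * (((2 * (n : ℝ) + 1) ^ 2 - y ^ 2) /
      (y ^ 2 + (2 * (n : ℝ) + 1) ^ 2) ^ 2)‖ ≤ 4 / π * (1 / (2 * (n : ℝ) + 1) ^ 2) := by
    intro n y
    have h0 : 0 < (2 * (n : ℝ) + 1) ^ 2 := by positivity
    generalize (2 * (n : ℝ) + 1) ^ 2 = c at *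
    have hy := sq_nonneg y
    rw [norm_mul, Real.norm_of_nonneg (show 0 ≤ 4 / π by positivity)]
    gcongr
    rw [Real.norm_eq_abs, abs_le]
    generalize y ^ 2 = d at *
    constructor
    · rw [← neg_div, div_le_div_iff₀ h0 (by positivity)]
      nlinarith [mul_nonneg hy h0.le]
    · rw [div_le_div_iff₀ (by positivity) h0]
      nlinarith [mul_nonneg hy h0.le]
  have hu := aux_l2.summable.mul_left (4 / π)
  have hd : HasDerivAt (fun y => ∑' n : ℕ, 4 / π * (y / (y ^ 2 + (2 * (n : ℝ) + 1) ^ 2))) 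
    (∑' n : ℕ, 4 / π * (((2 * (n : ℝ) + 1) ^ 2 - x ^ 2) /
      (x ^ 2 + (2 * (n : ℝ) + 1) ^ 2) ^ 2)) x := by
    refine hasDerivAt_tsum (g' := fun (n : ℕ) (y : ℝ) => 4 / π * (((2 * (n : ℝ) + 1) ^ 2 - y ^ 2) /
      (y ^ 2 + (2 * (n : ℝ) + 1) ^ 2) ^ 2)) hu ?_ hb (aux_tanh 0).summable x
    intro n y
    have h0 : y ^ 2 + (2 * (n : ℝ) + 1) ^ 2 ≠ 0 := by positivity
    convert! ((hasDerivAt_id y).div (((hasDerivAt_id y).pow 2).add_const _) h0).const_mul (4 / π)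
      using 1
    simp
    ring
  have hd2 : HasDerivAt (fun y => tanh (π / 2 * y)) (π / 2 * (1 / cosh (π / 2 * x)) ^ 2) x := by
    have hm : HasDerivAt (fun y : ℝ => π / 2 * y) (π / 2) x := by
      simpa using (hasDerivAt_id x).const_mul (π / 2)
    have := hm.sinh.div hm.cosh (cosh_pos _).ne'
    simp_rw [tanh_eq_sinh_div_cosh]
    convert! this using 1
    generalize π / 2 * x = w
    have hc := (cosh_pos w).ne'
    have := cosh_sq w
    field_simp
    linear_combination - this
  have he : (fun y => ∑' n : ℕ, 4 / π * (y / (y ^ 2 + (2 * (n : ℝ) + 1) ^ 2))) = 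
    (fun y => tanh (π / 2 * y)) := funext fun y => (aux_tanh y).tsum_eq
  rw [he] at hd
  rw [← hd.unique hd2]
  exact (Summable.of_norm_bounded hu (fun n => hb n x)).hasSum

/-- The summand of the double series. -/
noncomputable def auxG (p : ℕ × ℕ) : ℝ :=
  (3 * (2 * (p.2 : ℝ) + 1) ^ 2 + 5 * (2 * (p.1 : ℝ) + 1) ^ 2) /
    ((2 * (p.1 : ℝ) + 1) ^ 8 * ((2 * (p.1 : ℝ) + 1) ^ 2 + (2 * (p.2 : ℝ) + 1) ^ 2) ^ 2)

lemma aux_prod {f g : ℕ → ℝ} {a b : ℝ} (hf : HasSum f a) (hg : HasSum g b)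
    (hf0 : ∀ n, 0 ≤ f n) (hg0 : ∀ n, 0 ≤ g n) :
    HasSum (fun p : ℕ × ℕ => f p.1 * g p.2) (a * b) :=
  hf.mul hg (hf.summable.mul_of_nonneg hg.summable hf0 hg0)

lemma auxG_summable : Summable auxG := by
  have h := (aux_prod aux_l8 aux_l2 (fun n => by positivity) (fun n => by positivity)).summable
  refine Summable.of_nonneg_of_le (fun p => by unfold auxG; positivity) (fun p => ?_)
    (h.mul_left 5)
  unfold auxG
  have ha : 0 < 2 * (p.1 : ℝ) + 1 := by positivity
  have hb : 0 < 2 * (p.2 : ℝ) + 1 := by positivity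
  generalize 2 * (p.1 : ℝ) + 1 = a at *
  generalize 2 * (p.2 : ℝ) + 1 = b at *
  have : 5 * (1 / a ^ 8 * (1 / b ^ 2)) = 5 / (a ^ 8 * b ^ 2) := by field_simp
  rw [this, div_le_div_iff₀ (by positivity) (by positivity)]
  have key : (3 * b ^ 2 + 5 * a ^ 2) * b ^ 2 ≤ 5 * (a ^ 2 + b ^ 2) ^ 2 := by
    nlinarith [sq_nonneg (a ^ 2), sq_nonneg (b ^ 2), sq_nonneg (a * b)]
  nlinarith [mul_le_mul_of_nonneg_left key (show 0 ≤ a ^ 8 by positivity)]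

lemma auxG_hasSum : HasSum auxG (37 * π ^ 10 / 1290240) := by
  have h := auxG_summable.hasSum
  have hs : HasSum (fun p : ℕ × ℕ => auxG p.swap) (∑' p, auxG p) :=
    (Equiv.prodComm ℕ ℕ).hasSum_iff.mpr h
  have n0 : ∀ k n : ℕ, 0 ≤ (1 : ℝ) / (2 * (n : ℝ) + 1) ^ k := fun k n => by positivity
  have q1 := (aux_prod aux_l8 aux_l2 (n0 8) (n0 2)).mul_left 3
  have q2 := (aux_prod aux_l2 aux_l8 (n0 2) (n0 8)).mul_left 3
  have q3 := aux_prod aux_l6 aux_l4 (n0 6) (n0 4)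
  have q4 := aux_prod aux_l4 aux_l6 (n0 4) (n0 6)
  have q := ((q1.add q2).sub q3).sub q4
  have e : ∀ p : ℕ × ℕ, auxG p + auxG p.swap =
      3 * (1 / (2 * (p.1 : ℝ) + 1) ^ 8 * (1 / (2 * (p.2 : ℝ) + 1) ^ 2)) +
      3 * (1 / (2 * (p.1 : ℝ) + 1) ^ 2 * (1 / (2 * (p.2 : ℝ) + 1) ^ 8)) -
      1 / (2 * (p.1 : ℝ) + 1) ^ 6 * (1 / (2 * (p.2 : ℝ) + 1) ^ 4) -
      1 / (2 * (p.1 : ℝ) + 1) ^ 4 * (1 / (2 * (p.2 : ℝ) + 1) ^ 6) := by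
    intro p
    unfold auxG
    simp only [Prod.fst_swap, Prod.snd_swap]
    have ha : 0 < 2 * (p.1 : ℝ) + 1 := by positivity
    have hb : 0 < 2 * (p.2 : ℝ) + 1 := by positivity
    generalize 2 * (p.1 : ℝ) + 1 = a at *
    generalize 2 * (p.2 : ℝ) + 1 = b at *
    rw [add_comm (b ^ 2) (a ^ 2)]
    have hab : a ^ 2 + b ^ 2 ≠ 0 := by positivity
    field_simp
    ring
  have h2 := h.add hs
  rw [funext e] at h2
  have := h2.unique q
  have hv : ∑' p, auxG p = 37 * π ^ 10 / 1290240 := by linear_combination this / 2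
  rw [← hv]
  exact h

end Aux

/-- `4096 Σ_{n odd} tanh(nπ/2)/n^9 = 37π^9/315 + 512π Σ_{n odd} sech²(nπ/2)/n^8`,
sums over odd positive integers. -/
theorem tanh_sech_identity_nine :
    4096 * ∑' k : ℕ, Real.tanh ((2 * (k : ℝ) + 1) * Real.pi / 2) / (2 * (k : ℝ) + 1) ^ 9
      = 37 * Real.pi ^ 9 / 315 +
        512 * Real.pi * ∑' k : ℕ,
          (1 / Real.cosh ((2 * (k : ℝ) + 1) * Real.pi / 2)) ^ 2 / (2 * (k : ℝ) + 1) ^ 8 := by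
  have hp := Real.pi_pos
  have earg : ∀ k : ℕ, (2 * (k : ℝ) + 1) * Real.pi / 2 = Real.pi / 2 * (2 * (k : ℝ) + 1) :=
    fun k => by ring
  simp_rw [earg]
  have hfib : ∀ n : ℕ, HasSum (fun m : ℕ => 4 / Real.pi * auxG (n, m))
      (4 * (Real.tanh (Real.pi / 2 * (2 * (n : ℝ) + 1)) / (2 * (n : ℝ) + 1) ^ 9) -
        Real.pi / 2 * ((1 / Real.cosh (Real.pi / 2 * (2 * (n : ℝ) + 1))) ^ 2 /
          (2 * (n : ℝ) + 1) ^ 8)) := by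
    intro n
    have t1 := (aux_tanh (2 * (n : ℝ) + 1)).mul_left (4 / (2 * (n : ℝ) + 1) ^ 9)
    have t2 := (aux_sech (2 * (n : ℝ) + 1)).mul_left (1 / (2 * (n : ℝ) + 1) ^ 8)
    convert! t1.sub t2 using 1
    · ext m
      unfold auxG
      simp only
      have ha : 0 < 2 * (n : ℝ) + 1 := by positivity
      have hb : 0 < 2 * (m : ℝ) + 1 := by positivity
      generalize 2 * (n : ℝ) + 1 = a at *
      generalize 2 * (m : ℝ) + 1 = b at *
      field_simp
      ring
    · ring
  have hsum := (auxG_hasSum.mul_left (4 / Real.pi)).prod_fiberwise hfib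
  have hS : Summable (fun n : ℕ => (1 / Real.cosh (Real.pi / 2 * (2 * (n : ℝ) + 1))) ^ 2 /
          (2 * (n : ℝ) + 1) ^ 8) := by
    refine Summable.of_nonneg_of_le (fun n => by positivity) (fun n => ?_) aux_l8.summable
    gcongr
    have h1 := Real.one_le_cosh (Real.pi / 2 * (2 * (n : ℝ) + 1))
    exact pow_le_one₀ (by positivity) ((div_le_one (by positivity)).mpr h1)
  have hS' := hS.hasSum.mul_left (Real.pi / 2)
  have hT := (hsum.add hS').mul_left (1 / 4)
  have hT2 : (∑' n : ℕ, Real.tanh (Real.pi / 2 * (2 * (n : ℝ) + 1)) /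
      (2 * (n : ℝ) + 1) ^ 9) = _ := Eq.trans (tsum_congr fun n => by ring) hT.tsum_eq
  rw [hT2]
  field_simp
  ring
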